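/- Trilinear estimate in ℝ^{2+1}. Let s ∈ (4/7, 1) and let ε > 0 be sufficiently small. There is a constant C = C(s, ε) such that for every Schwartz function ψ on ℝ² × ℝ, ‖ψ · conj(ψ) · ψ‖_{X_{s, −1/2 + 2ε}} ≤ C ‖ψ‖³_{X_{s, 1/2 + ε}}. -/

import Mathlib

open MeasureTheory Complex Set
open scoped FourierTransform BigOperators RealInnerProductSpace

noncomputable section

abbrev Rn (n : ℕ) := EuclideanSpace ℝ (Fin n)

/-- Japanese bracket of a vector. -/
def jap {n : ℕ} (ξ : Rn n) : ℝ := Real.sqrt (1 + ‖ξ‖ ^ 2)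

/-- Japanese bracket of a real number. -/
def japR (x : ℝ) : ℝ := Real.sqrt (1 + x ^ 2)

/-- Inhomogeneous Sobolev norm ‖⟨ξ⟩^s f̂‖_{L²}. -/
def sobNorm (n : ℕ) (s : ℝ) (f : Rn n → ℂ) : ℝ :=
  (∫ ξ : Rn n, jap ξ ^ (2 * s) * ‖𝓕 f ξ‖ ^ 2) ^ (1/2 : ℝ)

/-- Homogeneous Sobolev norm ‖|ξ|^s f̂‖_{L²}. -/
def sobNormHom (n : ℕ) (s : ℝ) (f : Rn n → ℂ) : ℝ :=
  (∫ ξ : Rn n, ‖ξ‖ ^ (2 * s) * ‖𝓕 f ξ‖ ^ 2) ^ (1/2 : ℝ)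

/-- L^p norm on ℝⁿ. -/
def lpNorm (n : ℕ) (p : ℝ) (f : Rn n → ℂ) : ℝ :=
  (∫ x : Rn n, ‖f x‖ ^ p) ^ (1/p)

/-- Laplacian: sum of second partial derivatives. -/
def laplacian {n : ℕ} (f : Rn n → ℂ) (x : Rn n) : ℂ :=
  ∑ i : Fin n, fderiv ℝ (fun y => fderiv ℝ f y (EuclideanSpace.single i 1)) x
    (EuclideanSpace.single i 1)

/-- Complex gradient as a vector in Euclidean space. -/
def gradC {n : ℕ} (f : Rn n → ℂ) (x : Rn n) : EuclideanSpace ℂ (Fin n) :=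
  (WithLp.equiv 2 (Fin n → ℂ)).symm fun i => fderiv ℝ f x (EuclideanSpace.single i 1)

/-- φ is a solution of the cubic defocussing NLS on ℝⁿ × [0,T] with data φ₀:
smooth, Schwartz in x uniformly for t ∈ [0,T] (with all derivatives),
satisfying i∂ₜφ + Δφ = |φ|²φ and φ(·,0) = φ₀. -/
def IsNLSSolution (n : ℕ) (T : ℝ) (φ : Rn n → ℝ → ℂ) (φ₀ : Rn n → ℂ) : Prop :=
  ContDiff ℝ (⊤ : ℕ∞) (fun p : Rn n × ℝ => φ p.1 p.2) ∧
  (∀ k l : ℕ, ∃ C : ℝ, ∀ t ∈ Icc (0:ℝ) T, ∀ x : Rn n,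
      ‖x‖ ^ k * ‖iteratedFDeriv ℝ l (fun y => φ y t) x‖ ≤ C) ∧
  (∀ x : Rn n, ∀ t ∈ Icc (0:ℝ) T,
      Complex.I * deriv (fun t' => φ x t') t + laplacian (fun y => φ y t) x
        = (‖φ x t‖ : ℂ) ^ 2 * φ x t) ∧
  (∀ x : Rn n, φ x 0 = φ₀ x)

/-- The energy E(f) = ∫ (1/2)|∇f|² + (1/4)|f|⁴. -/
def energy {n : ℕ} (f : Rn n → ℂ) : ℝ :=
  ∫ x : Rn n, ((1/2 : ℝ) * ∑ i : Fin n, ‖fderiv ℝ f x (EuclideanSpace.single i 1)‖ ^ 2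
    + (1/4 : ℝ) * ‖f x‖ ^ 4)

/-- m₁ is a smooth, radially symmetric, nonincreasing multiplier with
m₁ = 1 on the unit ball, m₁(ξ) = |ξ|^{-(1-s)} for |ξ| ≥ 2, 0 < m₁ ≤ 1. -/
def IsAdmissibleMultiplier (n : ℕ) (s : ℝ) (m₁ : Rn n → ℝ) : Prop :=
  ContDiff ℝ (⊤ : ℕ∞) m₁ ∧
  (∀ ξ : Rn n, 0 < m₁ ξ ∧ m₁ ξ ≤ 1) ∧
  (∀ ξ η : Rn n, ‖ξ‖ = ‖η‖ → m₁ ξ = m₁ η) ∧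
  (∀ ξ η : Rn n, ‖ξ‖ ≤ ‖η‖ → m₁ η ≤ m₁ ξ) ∧
  (∀ ξ : Rn n, ‖ξ‖ ≤ 1 → m₁ ξ = 1) ∧
  (∀ ξ : Rn n, 2 ≤ ‖ξ‖ → m₁ ξ = ‖ξ‖ ^ (-(1 - s)))

/-- The rescaled multiplier m_N(ξ) = m₁(ξ/N). -/
def mN {n : ℕ} (m₁ : Rn n → ℝ) (N : ℝ) (ξ : Rn n) : ℝ := m₁ (N⁻¹ • ξ)

/-- The smoothing operator I_N with Fourier multiplier m_N. -/
def Iop {n : ℕ} (m₁ : Rn n → ℝ) (N : ℝ) (f : Rn n → ℂ) : Rn n → ℂ :=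
  fun x => 𝓕⁻ (fun ξ => (mN m₁ N ξ : ℂ) * 𝓕 f ξ) x

/-- The spatial multiplier ⟨∇⟩^s. -/
def japMul (n : ℕ) (s : ℝ) (f : Rn n → ℂ) : Rn n → ℂ :=
  fun x => 𝓕⁻ (fun ξ => ((jap ξ ^ s : ℝ) : ℂ) * 𝓕 f ξ) x

/-- Sharp Littlewood–Paley projection onto {M ≤ ⟨ξ⟩ ≤ 2M}. -/
def LP (n : ℕ) (M : ℝ) (f : Rn n → ℂ) : Rn n → ℂ :=
  fun x => 𝓕⁻ (fun ξ => if M ≤ jap ξ ∧ jap ξ ≤ 2 * M then 𝓕 f ξ else 0) x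

/-- Space-time Fourier transform ψ̃(ξ,τ). -/
def stFourier (n : ℕ) {E : Type*} [NormedAddCommGroup E] [NormedSpace ℂ E]
    (ψ : Rn n → ℝ → E) (ξ : Rn n) (τ : ℝ) : E :=
  ∫ x : Rn n, ∫ t : ℝ,
    Complex.exp (Complex.I * ((-2 * Real.pi * (⟪x, ξ⟫ + t * τ) : ℝ) : ℂ)) • ψ x t

/-- The X_{s,b} norm ‖⟨ξ⟩^s ⟨τ-|ξ|²⟩^b ψ̃‖_{L²}. -/
def XNorm (n : ℕ) {E : Type*} [NormedAddCommGroup E] [NormedSpace ℂ E]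
    (s b : ℝ) (ψ : Rn n → ℝ → E) : ℝ :=
  (∫ ξ : Rn n, ∫ τ : ℝ,
    jap ξ ^ (2 * s) * japR (τ - ‖ξ‖ ^ 2) ^ (2 * b) * ‖stFourier n ψ ξ τ‖ ^ 2) ^ (1/2 : ℝ)

/-- The restricted norm X^δ_{s,b}: infimum over Schwartz extensions off ℝⁿ × [0,δ]. -/
def XRNorm (n : ℕ) {E : Type*} [NormedAddCommGroup E] [NormedSpace ℂ E]
    (s b δ : ℝ) (f : Rn n → ℝ → E) : ℝ :=
  sInf { r : ℝ | ∃ ψ : SchwartzMap (Rn n × ℝ) E,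
    (∀ x : Rn n, ∀ t ∈ Icc (0:ℝ) δ, ψ (x, t) = f x t) ∧
    r = XNorm n s b (fun x t => ψ (x, t)) }

/-- Space-time L^p norm on ℝⁿ × ℝ. -/
def lpNormST (n : ℕ) {E : Type*} [NormedAddCommGroup E] (p : ℝ) (F : Rn n → ℝ → E) : ℝ :=
  (∫ t : ℝ, ∫ x : Rn n, ‖F x t‖ ^ p) ^ (1/p)

/-- Space-time L^p norm on ℝⁿ × [0,δ]. -/
def lpNormSTt (n : ℕ) {E : Type*} [NormedAddCommGroup E] (p δ : ℝ) (F : Rn n → ℝ → E) : ℝ :=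
  (∫ t in Icc (0:ℝ) δ, ∫ x : Rn n, ‖F x t‖ ^ p) ^ (1/p)

open scoped ENNReal

section Bilinear

variable {G : Type*} [AddCommGroup G] [MeasurableSpace G] [MeasurableAdd₂ G] [MeasurableNeg G]
  {μ : Measure G} [SFinite μ] [μ.IsAddLeftInvariant]

theorem lintegral_sq_lintegral {α β : Type*} [MeasurableSpace α] [MeasurableSpace β]
    {μ : Measure α} {ν : Measure β} [SFinite μ] [SFinite ν] {k : α → β → ℝ≥0∞}
    (hk : Measurable (Function.uncurry k)) :
    ∫⁻ u, (∫⁻ z, k u z ∂ν) ^ 2 ∂μ = ∫⁻ z, ∫⁻ z', ∫⁻ u, k u z * k u z' ∂μ ∂ν ∂ν := by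
  have hk1 (u : α) : Measurable (k u) := hk.of_uncurry_left
  have h1 : ∀ u, (∫⁻ z, k u z ∂ν) ^ 2 = ∫⁻ z, ∫⁻ z', k u z * k u z' ∂ν ∂ν := fun u => by
    rw [sq, ← lintegral_mul_const _ (hk1 u)]
    exact lintegral_congr fun z => (lintegral_const_mul _ (hk1 u)).symm
  have hm : Measurable fun p : (α × β) × β => k p.1.1 p.1.2 * k p.1.1 p.2 :=
    (hk.comp (by fun_prop : Measurable fun p : (α × β) × β => (p.1.1, p.1.2))).mul
      (hk.comp (by fun_prop : Measurable fun p : (α × β) × β => (p.1.1, p.2)))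
  simp_rw [h1]
  rw [lintegral_lintegral_swap hm.lintegral_prod_right'.aemeasurable]
  refine lintegral_congr fun z => ?_
  rw [lintegral_lintegral_swap]
  exact (hm.comp (by fun_prop : Measurable fun p : α × β => ((p.1, z), p.2))).aemeasurable

/-- Correlation and convolution of nonnegative functions have the same `L²` norm. -/
theorem lintegral_sq_correlation_eq_convolution {g h : G → ℝ≥0∞} (hg : Measurable g)
    (hh : Measurable h) :
    ∫⁻ u, (∫⁻ z, g (z + u) * h z ∂μ) ^ 2 ∂μ = ∫⁻ u, (∫⁻ z, g (u - z) * h z ∂μ) ^ 2 ∂μ := by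
  rw [lintegral_sq_lintegral (by unfold Function.uncurry; fun_prop),
    lintegral_sq_lintegral (by unfold Function.uncurry; fun_prop),
    lintegral_lintegral_swap (f := fun z z' => ∫⁻ u, g (u - z) * h z * (g (u - z') * h z') ∂μ)
      (Measurable.aemeasurable <| Measurable.lintegral_prod_right' (f := fun p : (G × G) × G =>
        g (p.2 - p.1.1) * h p.1.1 * (g (p.2 - p.1.2) * h p.1.2)) (by fun_prop))]
  refine lintegral_congr fun z => lintegral_congr fun z' => ?_
  rw [← lintegral_add_left_eq_self (μ := μ) _ (-z),
    ← lintegral_add_left_eq_self (μ := μ) (fun u => g (u - z') * h z' * (g (u - z) * h z)) z']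
  refine lintegral_congr fun u => ?_
  rw [show z + (-z + u) = u by abel, show z' + (-z + u) = z' + u - z by abel,
    show z' + u - z' = u by abel]
  ring

/-- Schur-type bound for a weighted convolution. -/
theorem lintegral_sq_convolution_le {p q g h : G → ℝ≥0∞} (hp : Measurable p) (hq : Measurable q)
    (hg : Measurable g) (hh : Measurable h) {K : ℝ≥0∞}
    (hK : ∀ u, ∫⁻ z, q (u - z) ^ 2 * p z ^ 2 ∂μ ≤ K) :
    ∫⁻ u, (∫⁻ z, (q (u - z) * g (u - z)) * (p z * h z) ∂μ) ^ 2 ∂μ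
      ≤ K * ((∫⁻ z, g z ^ 2 ∂μ) * ∫⁻ z, h z ^ 2 ∂μ) := by
  have hcs (u : G) : (∫⁻ z, (q (u - z) * g (u - z)) * (p z * h z) ∂μ) ^ 2
      ≤ K * ∫⁻ z, g (u - z) ^ 2 * h z ^ 2 ∂μ := by
    have := ENNReal.lintegral_mul_le_Lp_mul_Lq μ Real.HolderConjugate.two_two
      (f := fun z => q (u - z) * p z) (g := fun z => g (u - z) * h z) (by fun_prop) (by fun_prop)
    simp only [Pi.mul_apply, ENNReal.rpow_two, mul_pow] at this
    calc _ = (∫⁻ z, q (u - z) * p z * (g (u - z) * h z) ∂μ) ^ 2 := by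
          congr 2 with z; ring
      _ ≤ _ := pow_le_pow_left' this 2
      _ = (∫⁻ z, q (u - z) ^ 2 * p z ^ 2 ∂μ) * ∫⁻ z, g (u - z) ^ 2 * h z ^ 2 ∂μ := by
          rw [mul_pow, ← ENNReal.rpow_natCast, ← ENNReal.rpow_natCast, ← ENNReal.rpow_mul,
            ← ENNReal.rpow_mul]
          norm_num
      _ ≤ _ := by gcongr; exact hK u
  calc _ ≤ ∫⁻ u, K * ∫⁻ z, g (u - z) ^ 2 * h z ^ 2 ∂μ ∂μ := lintegral_mono hcs
    _ = K * ∫⁻ u, ∫⁻ z, g (u - z) ^ 2 * h z ^ 2 ∂μ ∂μ :=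
        lintegral_const_mul _ (Measurable.lintegral_prod_right'
          (f := fun p : G × G => g (p.1 - p.2) ^ 2 * h p.2 ^ 2) (by fun_prop))
    _ = K * ∫⁻ z, ∫⁻ u, g (u - z) ^ 2 * h z ^ 2 ∂μ ∂μ := by
        rw [lintegral_lintegral_swap (by fun_prop)]
    _ = _ := by
        congr 1
        rw [← lintegral_const_mul _ (by fun_prop)]
        refine lintegral_congr fun z => ?_
        rw [lintegral_mul_const _ (by fun_prop), lintegral_sub_right_eq_self (fun u => g u ^ 2)]

theorem lintegral_sq_correlation_le {p q g h : G → ℝ≥0∞} (hp : Measurable p) (hq : Measurable q)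
    (hg : Measurable g) (hh : Measurable h) {K : ℝ≥0∞}
    (hK : ∀ u, ∫⁻ z, q (u - z) ^ 2 * p z ^ 2 ∂μ ≤ K) :
    ∫⁻ u, (∫⁻ z, (q (z + u) * g (z + u)) * (p z * h z) ∂μ) ^ 2 ∂μ
      ≤ K * ((∫⁻ z, g z ^ 2 ∂μ) * ∫⁻ z, h z ^ 2 ∂μ) := by
  rw [lintegral_sq_correlation_eq_convolution (g := fun z => q z * g z) (h := fun z => p z * h z)
    (by fun_prop) (by fun_prop)]
  exact lintegral_sq_convolution_le hp hq hg hh hK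

theorem lintegral_sq_correlation_le' [μ.IsNegInvariant] {p q g h : G → ℝ≥0∞}
    (hp : Measurable p) (hq : Measurable q) (hg : Measurable g) (hh : Measurable h) {K : ℝ≥0∞}
    (hK : ∀ u, ∫⁻ z, q (u - z) ^ 2 * p z ^ 2 ∂μ ≤ K) :
    ∫⁻ u, (∫⁻ z, (p (z + u) * h (z + u)) * (q z * g z) ∂μ) ^ 2 ∂μ
      ≤ K * ((∫⁻ z, g z ^ 2 ∂μ) * ∫⁻ z, h z ^ 2 ∂μ) := by
  rw [lintegral_sq_correlation_eq_convolution (g := fun z => p z * h z) (h := fun z => q z * g z)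
    (by fun_prop) (by fun_prop)]
  refine le_of_eq_of_le (lintegral_congr fun u => ?_) (lintegral_sq_convolution_le hp hq hg hh hK)
  rw [← lintegral_sub_left_eq_self (μ := μ) _ u]
  congr 2 with z
  rw [sub_sub_cancel, mul_comm]

/-- Cauchy–Schwarz for the quadrilinear form over `z + z₂ = z₁ + z₃`. -/
theorem quadrilinear_sq_le {v a b c : G → ℝ≥0∞} (hv : Measurable v) (ha : Measurable a)
    (hb : Measurable b) (hc : Measurable c) :
    (∫⁻ z, ∫⁻ z₁, ∫⁻ z₂, v z * (a z₁ * b z₂ * c (z + z₂ - z₁)) ∂μ ∂μ ∂μ) ^ 2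
      ≤ (∫⁻ u, (∫⁻ z, v (z + u) * a z ∂μ) ^ 2 ∂μ) * ∫⁻ u, (∫⁻ z, c (z + u) * b z ∂μ) ^ 2 ∂μ := by
  have key : ∫⁻ z, ∫⁻ z₁, ∫⁻ z₂, v z * (a z₁ * b z₂ * c (z + z₂ - z₁)) ∂μ ∂μ ∂μ
      = ∫⁻ u, (∫⁻ z, v (z + u) * a z ∂μ) * ∫⁻ z, c (z + u) * b z ∂μ ∂μ := by
    have hm : Measurable fun p : (G × G) × G =>
        v p.1.1 * (a p.1.2 * b p.2 * c (p.1.1 + p.2 - p.1.2)) := by fun_prop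
    have hm' : Measurable fun p : (G × G) × G =>
        v (p.1.1 + p.1.2) * a p.1.1 * (c (p.2 + p.1.2) * b p.2) := by fun_prop
    rw [lintegral_lintegral_swap hm.lintegral_prod_right'.aemeasurable]
    calc _ = ∫⁻ z₁, ∫⁻ u, ∫⁻ z₂, v (z₁ + u) * a z₁ * (c (z₂ + u) * b z₂) ∂μ ∂μ ∂μ := by
          refine lintegral_congr fun z₁ => ?_
          rw [← lintegral_add_left_eq_self (μ := μ) _ z₁]
          refine lintegral_congr fun u => lintegral_congr fun z₂ => ?_
          rw [show z₁ + u + z₂ - z₁ = z₂ + u by abel]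
          ring
      _ = ∫⁻ u, ∫⁻ z₁, ∫⁻ z₂, v (z₁ + u) * a z₁ * (c (z₂ + u) * b z₂) ∂μ ∂μ ∂μ :=
          lintegral_lintegral_swap hm'.lintegral_prod_right'.aemeasurable
      _ = _ := by
          refine lintegral_congr fun u => ?_
          rw [← lintegral_mul_const _ (by fun_prop)]
          exact lintegral_congr fun z₁ => lintegral_const_mul _ (by fun_prop)
  have m1 : Measurable fun u => ∫⁻ z, v (z + u) * a z ∂μ :=
    Measurable.lintegral_prod_right' (f := fun p : G × G => v (p.2 + p.1) * a p.2) (by fun_prop)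
  have m2 : Measurable fun u => ∫⁻ z, c (z + u) * b z ∂μ :=
    Measurable.lintegral_prod_right' (f := fun p : G × G => c (p.2 + p.1) * b p.2) (by fun_prop)
  have := ENNReal.lintegral_mul_le_Lp_mul_Lq μ Real.HolderConjugate.two_two
    m1.aemeasurable m2.aemeasurable
  simp only [Pi.mul_apply, ENNReal.rpow_two] at this
  rw [key]
  refine (pow_le_pow_left' this 2).trans_eq ?_
  rw [mul_pow, ← ENNReal.rpow_natCast, ← ENNReal.rpow_natCast, ← ENNReal.rpow_mul,
    ← ENNReal.rpow_mul]
  norm_num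

theorem quadrilinear_symm [μ.IsNegInvariant] {v a b c : G → ℝ≥0∞} (ha : Measurable a)
    (hb : Measurable b) (hc : Measurable c) :
    ∫⁻ z, ∫⁻ z₁, ∫⁻ z₂, v z * (a z₁ * b z₂ * c (z + z₂ - z₁)) ∂μ ∂μ ∂μ
      = ∫⁻ z, ∫⁻ z₁, ∫⁻ z₂, v z * (c z₁ * b z₂ * a (z + z₂ - z₁)) ∂μ ∂μ ∂μ := by
  refine lintegral_congr fun z => ?_
  refine (lintegral_lintegral_swap (by fun_prop)).trans
    (Eq.trans (lintegral_congr fun z₂ => ?_) (lintegral_lintegral_swap (by fun_prop)).symm)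
  rw [← lintegral_sub_left_eq_self (μ := μ) _ (z + z₂)]
  refine lintegral_congr fun z₁ => ?_
  rw [sub_sub_cancel]
  ring

theorem lintegral_sq_trilinear_le [μ.IsNegInvariant] {J p q F H : G → ℝ≥0∞} (hJ : Measurable J)
    (hp : Measurable p) (hq : Measurable q) (hF : Measurable F) (hH : Measurable H)
    (hJadd : ∀ z z₁ z₂, J z ≤ J z₁ + J z₂ + J (z + z₂ - z₁)) (hJp : ∀ z, J z * p z ≤ q z)
    {K : ℝ≥0∞} (hK : ∀ u, ∫⁻ z, q (u - z) ^ 2 * p z ^ 2 ∂μ ≤ K)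
    (hHF : ∀ z, H z ≤ ∫⁻ z₁, ∫⁻ z₂, (p z₁ * F z₁) * (p z₂ * F z₂) *
      (p (z + z₂ - z₁) * F (z + z₂ - z₁)) ∂μ ∂μ)
    (hfin : ∫⁻ z, (J z * q z * H z) ^ 2 ∂μ ≠ ∞) :
    ∫⁻ z, (J z * q z * H z) ^ 2 ∂μ ≤ 9 * K ^ 2 * (∫⁻ z, F z ^ 2 ∂μ) ^ 3 := by
  set V : G → ℝ≥0∞ := fun z => J z * q z * H z with hV
  have mV : Measurable V := by fun_prop
  set I := ∫⁻ z, V z ^ 2 ∂μ with hI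
  set A := ∫⁻ z, F z ^ 2 ∂μ with hA
  set v : G → ℝ≥0∞ := fun z => q z * V z with hv
  set f : G → ℝ≥0∞ := fun z => p z * F z with hf
  set e : G → ℝ≥0∞ := fun z => q z * F z with he
  have mv : Measurable v := by fun_prop
  have mf : Measurable f := by fun_prop
  have me : Measurable e := by fun_prop
  let Q : (G → ℝ≥0∞) → (G → ℝ≥0∞) → (G → ℝ≥0∞) → ℝ≥0∞ := fun a b c =>
    ∫⁻ z, ∫⁻ z₁, ∫⁻ z₂, v z * (a z₁ * b z₂ * c (z + z₂ - z₁)) ∂μ ∂μ ∂μ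
  have Q3 : Q f f e ^ 2 ≤ K ^ 2 * A ^ 3 * I := by
    refine (quadrilinear_sq_le mv mf mf me).trans ((mul_le_mul'
      (lintegral_sq_correlation_le hp hq mV hF hK)
      (lintegral_sq_correlation_le hp hq hF hF hK)).trans_eq ?_)
    simp only [← hI, ← hA]
    ring
  have Q2 : Q f e f ^ 2 ≤ K ^ 2 * A ^ 3 * I := by
    refine (quadrilinear_sq_le mv mf me mf).trans ((mul_le_mul'
      (lintegral_sq_correlation_le hp hq mV hF hK)
      (lintegral_sq_correlation_le' hp hq hF hF hK)).trans_eq ?_)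
    simp only [← hI, ← hA]
    ring
  have Q1 : Q e f f ^ 2 ≤ K ^ 2 * A ^ 3 * I := by
    have : Q e f f = Q f f e := quadrilinear_symm me mf mf
    rwa [this]
  have hJf (z : G) : J z * f z ≤ e z := by
    simp only [hf, he, ← mul_assoc]
    gcongr
    exact hJp z
  have hsum : I ≤ Q e f f + Q f e f + Q f f e := by
    have hm (a b c : G → ℝ≥0∞) (ma : Measurable a) (mb : Measurable b) (mc : Measurable c) :
        Measurable fun z => ∫⁻ z₁, ∫⁻ z₂, v z * (a z₁ * b z₂ * c (z + z₂ - z₁)) ∂μ ∂μ := by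
      have : Measurable fun p : (G × G) × G =>
        v p.1.1 * (a p.1.2 * b p.2 * c (p.1.1 + p.2 - p.1.2)) := by fun_prop
      exact this.lintegral_prod_right'.lintegral_prod_right'
    have hm' (a b c : G → ℝ≥0∞) (ma : Measurable a) (mb : Measurable b) (mc : Measurable c)
        (z : G) : Measurable fun z₁ => ∫⁻ z₂, v z * (a z₁ * b z₂ * c (z + z₂ - z₁)) ∂μ := by
      have : Measurable fun p : G × G =>
        v z * (a p.1 * b p.2 * c (z + p.2 - p.1)) := by fun_prop
      exact this.lintegral_prod_right'
    simp only [Q]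
    rw [← lintegral_add_right _ (hm _ _ _ mf me mf), ← lintegral_add_right _ (hm _ _ _ mf mf me)]
    refine lintegral_mono fun z => ?_
    rw [← lintegral_add_right _ (hm' _ _ _ mf me mf z),
      ← lintegral_add_right _ (hm' _ _ _ mf mf me z)]
    calc V z ^ 2 = v z * J z * H z := by simp only [hv, hV]; ring
      _ ≤ v z * J z * ∫⁻ z₁, ∫⁻ z₂, f z₁ * f z₂ * f (z + z₂ - z₁) ∂μ ∂μ := by
          gcongr; exact hHF z
      _ = ∫⁻ z₁, ∫⁻ z₂, v z * J z * (f z₁ * f z₂ * f (z + z₂ - z₁)) ∂μ ∂μ := by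
          have : Measurable fun p : G × G => f p.1 * f p.2 * f (z + p.2 - p.1) := by fun_prop
          rw [← lintegral_const_mul _ this.lintegral_prod_right']
          exact lintegral_congr fun z₁ => (lintegral_const_mul _ (by fun_prop)).symm
      _ ≤ _ := by
          refine lintegral_mono fun z₁ => ?_
          rw [← lintegral_add_right _ (by fun_prop), ← lintegral_add_right _ (by fun_prop)]
          refine lintegral_mono fun z₂ => ?_
          calc _ ≤ v z * (J z₁ + J z₂ + J (z + z₂ - z₁)) * (f z₁ * f z₂ * f (z + z₂ - z₁)) := by
                gcongr; exact hJadd z z₁ z₂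
            _ = v z * ((J z₁ * f z₁) * f z₂ * f (z + z₂ - z₁))
                + v z * (f z₁ * (J z₂ * f z₂) * f (z + z₂ - z₁))
                + v z * (f z₁ * f z₂ * (J (z + z₂ - z₁) * f (z + z₂ - z₁))) := by ring
            _ ≤ _ := by gcongr <;> exact hJf _
  set R := (K ^ 2 * A ^ 3 * I) ^ (1 / 2 : ℝ) with hR
  have hR2 : R ^ 2 = K ^ 2 * A ^ 3 * I := by
    rw [hR, ← ENNReal.rpow_natCast, ← ENNReal.rpow_mul]; norm_num
  have hle {x : ℝ≥0∞} (hx : x ^ 2 ≤ K ^ 2 * A ^ 3 * I) : x ≤ R := by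
    rw [← hR2] at hx
    exact (ENNReal.pow_le_pow_left_iff two_ne_zero).1 hx
  have h3 : I ≤ 3 * R := by
    refine hsum.trans ((add_le_add (add_le_add (hle Q1) (hle Q2)) (hle Q3)).trans_eq ?_)
    ring
  rcases eq_or_ne I 0 with h0 | h0
  · rw [h0]; exact zero_le
  have h4 : I * I ≤ 9 * K ^ 2 * A ^ 3 * I := by
    calc I * I = I ^ 2 := (sq I).symm
      _ ≤ (3 * R) ^ 2 := pow_le_pow_left' h3 2
      _ = _ := by rw [mul_pow, hR2]; ring
  exact (ENNReal.mul_le_mul_iff_left h0 hfin).1 h4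

end Bilinear

/-- Polar coordinates for radial functions on the plane. -/
theorem lintegral_radial_le {g : ℝ → ℝ≥0∞} (hg : Measurable g) (c : ℝ) :
    ∫⁻ x : Rn 2, g (c - 2 * ‖x‖ ^ 2) ≤
      (volume : Measure (Rn 2)).toSphere univ * ∫⁻ ρ, g ρ := by
  have h1 : ∫⁻ x : Rn 2, g (c - 2 * ‖x‖ ^ 2)
      = (volume : Measure (Rn 2)).toSphere univ *
        ∫⁻ r in Ioi (0 : ℝ), ENNReal.ofReal r * g (c - 2 * r ^ 2) := by
    calc _ = ∫⁻ x : ({(0)}ᶜ : Set (Rn 2)), g (c - 2 * ‖x.1‖ ^ 2)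
          ∂((volume : Measure (Rn 2)).comap Subtype.val) := by
          rw [lintegral_subtype_comap (measurableSet_singleton _).compl
            fun x => g (c - 2 * ‖x‖ ^ 2), restrict_compl_singleton]
      _ = ∫⁻ x, g (c - 2 * x.2.1 ^ 2) ∂(volume : Measure (Rn 2)).toSphere.prod
            (.volumeIoiPow (Module.finrank ℝ (Rn 2) - 1)) := by
          have hmp := (volume : Measure (Rn 2)).measurePreserving_homeomorphUnitSphereProd
          refine Eq.trans ?_ (hmp.lintegral_comp_emb (Homeomorph.measurableEmbedding _) _)
          simp
      _ = (∫⁻ r : Ioi (0 : ℝ), g (c - 2 * r.1 ^ 2)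
              ∂(Measure.volumeIoiPow (Module.finrank ℝ (Rn 2) - 1))) *
            (volume : Measure (Rn 2)).toSphere univ := by
          rw [lintegral_prod _ (by fun_prop)]
          simp
      _ = _ := by
          rw [mul_comm, Measure.volumeIoiPow,
            lintegral_withDensity_eq_lintegral_mul _ (by fun_prop) (by fun_prop)]
          simp only [Pi.mul_apply, finrank_euclideanSpace_fin]
          rw [lintegral_subtype_comap measurableSet_Ioi
            fun r : ℝ => ENNReal.ofReal (r ^ (2 - 1)) * g (c - 2 * r ^ 2)]
          simp
  have h2 : ∫⁻ r in Ioi (0 : ℝ), ENNReal.ofReal r * g (c - 2 * r ^ 2) ≤ ∫⁻ ρ, g ρ := by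
    calc _ ≤ ∫⁻ r in Ioi (0 : ℝ), ENNReal.ofReal |-(4 * r)| * g (c - 2 * r ^ 2) := by
          refine setLIntegral_mono (by fun_prop) fun r hr => ?_
          gcongr
          rw [abs_neg, abs_of_pos (by linarith [mem_Ioi.1 hr])]
          linarith [mem_Ioi.1 hr]
      _ = ∫⁻ ρ in (fun r : ℝ => c - 2 * r ^ 2) '' Ioi 0, g ρ := by
          refine (lintegral_image_eq_lintegral_abs_deriv_mul measurableSet_Ioi (fun r _ => ?_)
            (fun r hr r' hr' h => ?_) g).symm
          · have := ((hasDerivAt_pow 2 r).const_mul 2).const_sub c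
            exact (this.congr_deriv (by push_cast; ring)).hasDerivWithinAt
          · have h' : r ^ 2 = r' ^ 2 := by simpa using h
            exact (pow_left_inj₀ (le_of_lt hr) (le_of_lt hr') two_ne_zero).1 h'
      _ ≤ _ := setLIntegral_le_lintegral _ _
  rw [h1]
  gcongr

theorem one_le_japR (x : ℝ) : 1 ≤ japR x := Real.one_le_sqrt.2 (by nlinarith [sq_nonneg x])

theorem one_le_jap {n : ℕ} (ξ : Rn n) : 1 ≤ jap ξ :=
  Real.one_le_sqrt.2 (by nlinarith [sq_nonneg ‖ξ‖])

@[fun_prop] theorem continuous_japR : Continuous japR := by unfold japR; fun_prop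

@[fun_prop] theorem continuous_jap {n : ℕ} : Continuous (jap (n := n)) := by unfold jap; fun_prop

@[fun_prop] theorem continuous_japR_rpow (r : ℝ) : Continuous fun x => japR x ^ r :=
  continuous_japR.rpow_const fun x => Or.inl (by linarith [one_le_japR x])

@[fun_prop] theorem continuous_jap_rpow {n : ℕ} (r : ℝ) : Continuous fun ξ : Rn n => jap ξ ^ r :=
  continuous_jap.rpow_const fun x => Or.inl (by linarith [one_le_jap x])

theorem lintegral_jap_rpow_lt_top {n : ℕ} {r : ℝ} (hr : n < r) :
    ∫⁻ ξ : Rn n, ENNReal.ofReal (jap ξ ^ (-r)) < ∞ := by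
  have := integrable_rpow_neg_one_add_norm_sq (E := Rn n) (μ := volume) (r := r) (by simpa using hr)
  refine (this.congr (ae_of_all _ fun ξ => ?_)).lintegral_lt_top
  rw [jap, Real.sqrt_eq_rpow, ← Real.rpow_mul (by positivity)]
  ring_nf

theorem lintegral_japR_rpow_lt_top {r : ℝ} (hr : 1 < r) :
    ∫⁻ x : ℝ, ENNReal.ofReal (japR x ^ (-r)) < ∞ := by
  have := integrable_rpow_neg_one_add_norm_sq (E := ℝ) (μ := volume) (r := r) (by simpa using hr)
  refine (this.congr (ae_of_all _ fun ξ => ?_)).lintegral_lt_top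
  simp only [japR, Real.sqrt_eq_rpow]
  rw [← Real.rpow_mul (by positivity), Real.norm_eq_abs, sq_abs]
  ring_nf

/-- The distance of `(ξ, τ)` to the paraboloid, along the time frequency axis. -/
def modulation {n : ℕ} (z : Rn n × ℝ) : ℝ := japR (z.2 - ‖z.1‖ ^ 2)

theorem one_le_modulation {n : ℕ} (z : Rn n × ℝ) : 1 ≤ modulation z := one_le_japR _

@[fun_prop] theorem continuous_modulation_rpow {n : ℕ} (r : ℝ) :
    Continuous fun z : Rn n × ℝ => modulation z ^ r := by
  unfold modulation
  exact (continuous_japR_rpow r).comp (by fun_prop)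

theorem kernel_bound {s b b' : ℝ} (hs : 1 < 2 * s) (hb : 1 < 2 * b) (hb' : 1 < 4 * b') :
    ∃ K : ℝ≥0∞, K < ∞ ∧ ∀ u : Rn 2 × ℝ,
      ∫⁻ z : Rn 2 × ℝ, ENNReal.ofReal (modulation (u - z) ^ (-b')) ^ 2 *
        ENNReal.ofReal (jap z.1 ^ (-s) * modulation z ^ (-b)) ^ 2 ≤ K := by
  set B : ℝ → ℝ≥0∞ := fun x => ENNReal.ofReal (japR x ^ (-(2 * b))) with hB
  set D : ℝ → ℝ≥0∞ := fun x => ENNReal.ofReal (japR x ^ (-(4 * b'))) with hD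
  set S : Rn 2 → ℝ≥0∞ := fun x => ENNReal.ofReal (jap x ^ (-(4 * s))) with hS
  have mB : Measurable B := by fun_prop
  have mD : Measurable D := by fun_prop
  have mS : Measurable S := by fun_prop
  refine ⟨(∫⁻ x, B x) * (∫⁻ ξ, S ξ) +
    (∫⁻ x, B x) * ((volume : Measure (Rn 2)).toSphere univ * ∫⁻ x, D x), ?_, fun u => ?_⟩
  · have h1 : ∫⁻ x, B x < ∞ := lintegral_japR_rpow_lt_top hb
    have h2 : ∫⁻ x, D x < ∞ := lintegral_japR_rpow_lt_top hb'
    have h3 : ∫⁻ x, S x < ∞ := lintegral_jap_rpow_lt_top (by push_cast; linarith)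
    exact ENNReal.add_lt_top.2 ⟨ENNReal.mul_lt_top h1 h3,
      ENNReal.mul_lt_top h1 (ENNReal.mul_lt_top (measure_lt_top _ _) h2)⟩
  calc _ ≤ ∫⁻ z : Rn 2 × ℝ, (B (z.2 - ‖z.1‖ ^ 2) * S z.1 +
          B (z.2 - ‖z.1‖ ^ 2) * D (u.2 - z.2 - ‖u.1 - z.1‖ ^ 2)) := by
        refine lintegral_mono fun z => ?_
        have e1 : B (z.2 - ‖z.1‖ ^ 2) = ENNReal.ofReal ((modulation z ^ (-b)) ^ 2) := by
          rw [hB, modulation, ← Real.rpow_mul_natCast (by linarith [one_le_japR (z.2 - ‖z.1‖ ^ 2)])]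
          push_cast; ring_nf
        have e2 : D (u.2 - z.2 - ‖u.1 - z.1‖ ^ 2)
            = ENNReal.ofReal ((modulation (u - z) ^ (-b')) ^ 4) := by
          rw [hD, modulation, ← Real.rpow_mul_natCast
            (by linarith [one_le_japR ((u - z).2 - ‖(u - z).1‖ ^ 2)])]
          push_cast; simp only [Prod.fst_sub, Prod.snd_sub]; ring_nf
        have e3 : S z.1 = ENNReal.ofReal ((jap z.1 ^ (-s)) ^ 4) := by
          rw [hS, ← Real.rpow_mul_natCast (by linarith [one_le_jap z.1])]
          push_cast; ring_nf
        have p1 : 0 ≤ modulation z ^ (-b) := Real.rpow_nonneg (by linarith [one_le_modulation z]) _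
        have p2 : 0 ≤ modulation (u - z) ^ (-b') :=
          Real.rpow_nonneg (by linarith [one_le_modulation (u - z)]) _
        have p3 : 0 ≤ jap z.1 ^ (-s) := Real.rpow_nonneg (by linarith [one_le_jap z.1]) _
        rw [e1, e2, e3, ← ENNReal.ofReal_pow p2, ← ENNReal.ofReal_pow (by positivity),
          ← ENNReal.ofReal_mul (by positivity), ← ENNReal.ofReal_mul (by positivity),
          ← ENNReal.ofReal_mul (by positivity), ← ENNReal.ofReal_add (by positivity) (by positivity)]
        refine ENNReal.ofReal_le_ofReal ?_
        generalize modulation z ^ (-b) = x at *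
        generalize modulation (u - z) ^ (-b') = y at *
        generalize jap z.1 ^ (-s) = w at *
        have h : y ^ 2 * w ^ 2 ≤ w ^ 4 + y ^ 4 := by
          nlinarith [sq_nonneg (y ^ 2 - w ^ 2), sq_nonneg (y ^ 2), sq_nonneg (w ^ 2)]
        nlinarith [mul_le_mul_of_nonneg_left h (sq_nonneg x)]
    _ = (∫⁻ z : Rn 2 × ℝ, B (z.2 - ‖z.1‖ ^ 2) * S z.1) + ∫⁻ z : Rn 2 × ℝ,
          B (z.2 - ‖z.1‖ ^ 2) * D (u.2 - z.2 - ‖u.1 - z.1‖ ^ 2) :=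
        lintegral_add_left (by fun_prop) _
    _ ≤ _ := by
        gcongr ?_ + ?_
        · rw [Measure.volume_eq_prod, lintegral_prod _ (by fun_prop), ← lintegral_const_mul _ mS]
          refine le_of_eq (lintegral_congr fun ξ => ?_)
          simp only
          rw [lintegral_mul_const _ (by fun_prop), lintegral_sub_right_eq_self B]
        · rw [Measure.volume_eq_prod, lintegral_prod _ (by fun_prop)]
          calc _ = ∫⁻ ξ : Rn 2, ∫⁻ a : ℝ, B a * D (u.2 - a - ‖u.1‖ ^ 2 / 2
                    - 2 * ‖ξ - (1 / 2 : ℝ) • u.1‖ ^ 2) := by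
                refine lintegral_congr fun ξ => ?_
                rw [← lintegral_add_right_eq_self _ (‖ξ‖ ^ 2)]
                refine lintegral_congr fun a => ?_
                congr 2
                · simp
                · simp only [norm_sub_sq_real, inner_smul_right, norm_smul, real_inner_comm]
                  norm_num
                  ring
            _ = ∫⁻ a : ℝ, B a * ∫⁻ ξ : Rn 2, D (u.2 - a - ‖u.1‖ ^ 2 / 2
                    - 2 * ‖ξ - (1 / 2 : ℝ) • u.1‖ ^ 2) := by
                rw [lintegral_lintegral_swap (by fun_prop)]
                exact lintegral_congr fun a => lintegral_const_mul _ (by fun_prop)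
            _ ≤ ∫⁻ a : ℝ, B a * ((volume : Measure (Rn 2)).toSphere univ * ∫⁻ x, D x) := by
                refine lintegral_mono fun a => ?_
                gcongr
                rw [lintegral_sub_right_eq_self (fun ξ : Rn 2 => D (u.2 - a - ‖u.1‖ ^ 2 / 2
                    - 2 * ‖ξ‖ ^ 2))]
                exact lintegral_radial_le mD _
            _ = _ := lintegral_mul_const _ mB

open SchwartzMap

theorem stFourier_eq_fourier {n : ℕ} (φ : 𝓢(WithLp 2 (Rn n × ℝ), ℂ)) (ξ : Rn n) (τ : ℝ) :
    stFourier n (fun x t => φ (WithLp.toLp 2 (x, t))) ξ τ = 𝓕 φ (WithLp.toLp 2 (ξ, τ)) := by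
  have hmp := WithLp.volume_preserving_toLp (Rn n) ℝ
  have hemb : MeasurableEmbedding (WithLp.toLp 2 : Rn n × ℝ → WithLp 2 (Rn n × ℝ)) :=
    (MeasurableEquiv.toLp 2 (Rn n × ℝ)).measurableEmbedding
  have hint := (Real.fourierIntegral_convergent_iff (WithLp.toLp 2 (ξ, τ))).2
    (φ.integrable (μ := volume))
  rw [← hmp.integrable_comp_emb hemb] at hint
  have key := integral_prod _ hint
  simp only [Function.comp_apply] at key
  rw [fourier_coe, Real.fourier_eq, ← hmp.integral_comp hemb, Measure.volume_eq_prod, key, stFourier]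
  congr 1 with x
  congr 1 with t
  rw [Circle.smul_def, Real.fourierChar_apply, WithLp.prod_inner_apply]
  congr 2
  simp only [RCLike.inner_apply]
  push_cast
  simp
  ring

/-- The complex conjugate of a Schwartz function. -/
def conjSchwartz {E : Type*} [NormedAddCommGroup E] [NormedSpace ℝ E] (φ : 𝓢(E, ℂ)) : 𝓢(E, ℂ) :=
  φ.postcompCLM (Complex.conjCLE : ℂ →L[ℝ] ℂ)

section Fourier

variable {E : Type*} [NormedAddCommGroup E] [InnerProductSpace ℝ E] [FiniteDimensional ℝ E]
  [MeasurableSpace E] [BorelSpace E]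

theorem enorm_fourier_conjSchwartz (φ : 𝓢(E, ℂ)) (w : E) :
    ‖𝓕 (conjSchwartz φ) w‖ₑ = ‖𝓕 φ (-w)‖ₑ := by
  rw [← RCLike.enorm_conj (𝓕 φ (-w)), fourier_coe, fourier_coe, Real.fourier_eq, Real.fourier_eq,
    ← integral_conj]
  congr 2 with x
  simp [conjSchwartz, Circle.smul_def, ← Circle.coe_inv_eq_conj, AddChar.map_neg_eq_inv]

theorem fourierInv_eq_fourier_neg (f : 𝓢(E, ℂ)) (w : E) : 𝓕⁻ f w = 𝓕 f (-w) := by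
  rw [fourierInv_coe, fourier_coe, Real.fourierInv_eq_fourier_neg]

theorem fourierInv_pairing_mul (f g : 𝓢(E, ℂ)) :
    𝓕⁻ (pairing (ContinuousLinearMap.mul ℂ ℂ) f g)
      = SchwartzMap.convolution (ContinuousLinearMap.mul ℂ ℂ) (𝓕⁻ f) (𝓕⁻ g) := by
  refine .trans ?_ (FourierTransform.fourierInv_fourier_eq (F := 𝓢(E, ℂ)) _)
  rw [SchwartzMap.fourier_convolution, FourierTransform.fourier_fourierInv_eq,
    FourierTransform.fourier_fourierInv_eq]

theorem enorm_fourier_pairing_mul_le (f g : 𝓢(E, ℂ)) (w : E) :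
    ‖𝓕 (pairing (ContinuousLinearMap.mul ℂ ℂ) f g) w‖ₑ
      ≤ ∫⁻ y, ‖𝓕 f y‖ₑ * ‖𝓕 g (w - y)‖ₑ := by
  rw [← neg_neg w, ← fourierInv_eq_fourier_neg, fourierInv_pairing_mul,
    SchwartzMap.convolution_apply, MeasureTheory.convolution, neg_neg, ← lintegral_neg_eq_self]
  refine (enorm_integral_le_lintegral_enorm _).trans_eq (lintegral_congr fun y => ?_)
  rw [ContinuousLinearMap.mul_apply', enorm_mul, fourierInv_eq_fourier_neg,
    fourierInv_eq_fourier_neg]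
  congr 3
  abel

/-- The cubic nonlinearity `φ * (conj φ * φ)`. -/
def cubicSchwartz (φ : 𝓢(E, ℂ)) : 𝓢(E, ℂ) :=
  pairing (ContinuousLinearMap.mul ℂ ℂ) φ
    (pairing (ContinuousLinearMap.mul ℂ ℂ) (conjSchwartz φ) φ)

theorem enorm_fourier_cubicSchwartz_le (φ : 𝓢(E, ℂ)) (w : E) :
    ‖𝓕 (cubicSchwartz φ) w‖ₑ
      ≤ ∫⁻ w₁, ∫⁻ w₂, ‖𝓕 φ w₁‖ₑ * ‖𝓕 φ w₂‖ₑ * ‖𝓕 φ (w + w₂ - w₁)‖ₑ := by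
  refine (enorm_fourier_pairing_mul_le _ _ w).trans (lintegral_mono fun w₁ => ?_)
  simp_rw [mul_assoc]
  rw [lintegral_const_mul' _ _ enorm_ne_top]
  gcongr
  refine (enorm_fourier_pairing_mul_le _ _ _).trans_eq ?_
  rw [← lintegral_neg_eq_self]
  refine lintegral_congr fun w₂ => ?_
  rw [enorm_fourier_conjSchwartz, neg_neg]
  congr 3
  abel

end Fourier

theorem jap_rpow_le_add {n : ℕ} {s : ℝ} (hs₀ : 0 ≤ s) (hs₁ : s ≤ 1) (ξ ξ₁ ξ₂ : Rn n) :
    jap ξ ^ s ≤ jap ξ₁ ^ s + jap ξ₂ ^ s + jap (ξ + ξ₂ - ξ₁) ^ s := by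
  have h0 (η : Rn n) : 0 ≤ jap η := Real.sqrt_nonneg _
  have hle (η : Rn n) : ‖η‖ ≤ jap η := Real.le_sqrt_of_sq_le (by linarith)
  have hsq (η : Rn n) : jap η ^ 2 = 1 + ‖η‖ ^ 2 := Real.sq_sqrt (by positivity)
  set ξ₃ := ξ + ξ₂ - ξ₁ with h₃
  have hξ : ‖ξ‖ ≤ ‖ξ₁‖ + ‖ξ₂‖ + ‖ξ₃‖ := by
    have : ξ = ξ₁ - ξ₂ + ξ₃ := by rw [h₃]; abel
    calc ‖ξ‖ = ‖ξ₁ - ξ₂ + ξ₃‖ := by rw [← this]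
      _ ≤ ‖ξ₁ - ξ₂‖ + ‖ξ₃‖ := norm_add_le _ _
      _ ≤ _ := by gcongr; exact norm_sub_le _ _
  have hadd : jap ξ ≤ jap ξ₁ + jap ξ₂ + jap ξ₃ := by
    refine Real.sqrt_le_iff.2 ⟨add_nonneg (add_nonneg (h0 _) (h0 _)) (h0 _), ?_⟩
    have h12 := mul_le_mul (hle ξ₁) (hle ξ₂) (norm_nonneg _) (h0 _)
    have h13 := mul_le_mul (hle ξ₁) (hle ξ₃) (norm_nonneg _) (h0 _)
    have h23 := mul_le_mul (hle ξ₂) (hle ξ₃) (norm_nonneg _) (h0 _)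
    have := pow_le_pow_left₀ (norm_nonneg _) hξ 2
    linarith [hsq ξ₁, hsq ξ₂, hsq ξ₃]
  calc jap ξ ^ s ≤ (jap ξ₁ + jap ξ₂ + jap ξ₃) ^ s := Real.rpow_le_rpow (h0 _) hadd hs₀
    _ ≤ (jap ξ₁ + jap ξ₂) ^ s + jap ξ₃ ^ s :=
        Real.rpow_add_le_add_rpow (add_nonneg (h0 _) (h0 _)) (h0 _) hs₀ hs₁
    _ ≤ _ := by gcongr; exact Real.rpow_add_le_add_rpow (h0 _) (h0 _) hs₀ hs₁

theorem weight_le {n : ℕ} {s b : ℝ} (hs : s ≤ 1) (hb : b ≤ 1) (z : Rn n × ℝ) :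
    jap z.1 ^ (2 * s) * modulation z ^ (2 * b) ≤ 9 * (1 + ‖WithLp.toLp 2 z‖ ^ 6) := by
  have h1 : jap z.1 ^ (2 * s) ≤ 1 + ‖z.1‖ ^ 2 := by
    calc jap z.1 ^ (2 * s) ≤ jap z.1 ^ (2 : ℝ) :=
          Real.rpow_le_rpow_of_exponent_le (one_le_jap _) (by linarith)
      _ = _ := by rw [Real.rpow_two, jap, Real.sq_sqrt (by positivity)]
  have h2 : modulation z ^ (2 * b) ≤ 1 + (z.2 - ‖z.1‖ ^ 2) ^ 2 := by
    calc modulation z ^ (2 * b) ≤ modulation z ^ (2 : ℝ) :=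
          Real.rpow_le_rpow_of_exponent_le (one_le_modulation _) (by linarith)
      _ = _ := by rw [Real.rpow_two, modulation, japR, Real.sq_sqrt (by positivity)]
  have hN : ‖WithLp.toLp 2 z‖ ^ 2 = ‖z.1‖ ^ 2 + z.2 ^ 2 := by
    rw [WithLp.prod_norm_sq_eq_of_L2, Real.norm_eq_abs, sq_abs]; rfl
  set x := ‖WithLp.toLp 2 z‖ ^ 2 with hx
  have h6 : ‖WithLp.toLp 2 z‖ ^ 6 = x ^ 3 := by rw [hx]; ring
  have hx0 : 0 ≤ x := by positivity
  have ha : ‖z.1‖ ^ 2 ≤ x := by nlinarith [sq_nonneg z.2]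
  have hτ : z.2 ^ 2 ≤ x := by nlinarith [sq_nonneg ‖z.1‖]
  have h3 : (z.2 - ‖z.1‖ ^ 2) ^ 2 ≤ 2 * x + 2 * x ^ 2 := by
    nlinarith [sq_nonneg (z.2 + ‖z.1‖ ^ 2), pow_le_pow_left₀ (sq_nonneg ‖z.1‖) ha 2]
  calc _ ≤ (1 + ‖z.1‖ ^ 2) * (1 + (z.2 - ‖z.1‖ ^ 2) ^ 2) :=
        mul_le_mul h1 h2 (Real.rpow_nonneg (zero_le_one.trans (one_le_modulation z)) _)
          (by positivity)
    _ ≤ (1 + x) * (1 + (2 * x + 2 * x ^ 2)) := by gcongr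
    _ ≤ 9 * (1 + x ^ 3) := by
      nlinarith [mul_nonneg hx0 (sq_nonneg (x - 1)), sq_nonneg (x - 1), pow_nonneg hx0 3]
    _ = _ := by rw [h6]

theorem integrable_weight_mul_sq {n : ℕ} {s b : ℝ} (hs : s ≤ 1) (hb : b ≤ 1)
    (f : 𝓢(WithLp 2 (Rn n × ℝ), ℂ)) :
    Integrable fun z : Rn n × ℝ =>
      jap z.1 ^ (2 * s) * modulation z ^ (2 * b) * ‖f (WithLp.toLp 2 z)‖ ^ 2 := by
  have hmp := WithLp.volume_preserving_toLp (Rn n) ℝ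
  have hemb : MeasurableEmbedding (WithLp.toLp 2 : Rn n × ℝ → WithLp 2 (Rn n × ℝ)) :=
    (MeasurableEquiv.toLp 2 (Rn n × ℝ)).measurableEmbedding
  have hint : Integrable fun w : WithLp 2 (Rn n × ℝ) =>
      9 * SchwartzMap.seminorm ℝ 0 0 f * (‖f w‖ + ‖w‖ ^ 6 * ‖f w‖) :=
    ((f.integrable (μ := volume)).norm.add (f.integrable_pow_mul volume 6)).const_mul _
  rw [← hmp.integrable_comp_emb hemb] at hint
  have hf : Continuous fun z : Rn n × ℝ => f (WithLp.toLp 2 z) :=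
    f.continuous.comp (WithLp.prod_continuous_toLp 2 _ _)
  refine hint.mono' 
    (((((continuous_jap_rpow _).comp continuous_fst).mul (continuous_modulation_rpow _)).mul
      (hf.norm.pow 2)).aestronglyMeasurable) (ae_of_all _ fun z => ?_)
  have hw : 0 ≤ jap z.1 ^ (2 * s) * modulation z ^ (2 * b) :=
    mul_nonneg (Real.rpow_nonneg (Real.sqrt_nonneg _) _) (Real.rpow_nonneg (Real.sqrt_nonneg _) _)
  rw [Real.norm_of_nonneg (mul_nonneg hw (sq_nonneg _))]
  calc _ ≤ 9 * (1 + ‖WithLp.toLp 2 z‖ ^ 6)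
        * (SchwartzMap.seminorm ℝ 0 0 f * ‖f (WithLp.toLp 2 z)‖) := by
        rw [sq]
        exact mul_le_mul (weight_le hs hb z)
          (mul_le_mul_of_nonneg_right (norm_le_seminorm ℝ f _) (norm_nonneg _)) (by positivity)
          (by positivity)
    _ = _ := by simp only [Function.comp_apply]; ring

theorem lintegral_eq_XNorm_sq {n : ℕ} {s b : ℝ} (hs : s ≤ 1) (hb : b ≤ 1)
    (φ : 𝓢(WithLp 2 (Rn n × ℝ), ℂ)) :
    ∫⁻ z : Rn n × ℝ, (ENNReal.ofReal (jap z.1 ^ s) * ENNReal.ofReal (modulation z ^ b)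
        * ‖𝓕 φ (WithLp.toLp 2 z)‖ₑ) ^ 2
      = ENNReal.ofReal (XNorm n s b (fun x t => φ (WithLp.toLp 2 (x, t))) ^ 2) := by
  have hint := integrable_weight_mul_sq hs hb (𝓕 φ)
  have h0 (z : Rn n × ℝ) :
      0 ≤ jap z.1 ^ (2 * s) * modulation z ^ (2 * b) * ‖𝓕 φ (WithLp.toLp 2 z)‖ ^ 2 :=
    mul_nonneg (mul_nonneg (Real.rpow_nonneg (Real.sqrt_nonneg _) _)
      (Real.rpow_nonneg (Real.sqrt_nonneg _) _)) (sq_nonneg _)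
  have hX : XNorm n s b (fun x t => φ (WithLp.toLp 2 (x, t))) ^ 2
      = ∫ z : Rn n × ℝ,
        jap z.1 ^ (2 * s) * modulation z ^ (2 * b) * ‖𝓕 φ (WithLp.toLp 2 z)‖ ^ 2 := by
    rw [Measure.volume_eq_prod] at hint ⊢
    rw [integral_prod _ hint, XNorm, ← Real.rpow_mul_natCast]
    · simp_rw [stFourier_eq_fourier]
      norm_num [modulation]
    · exact integral_nonneg fun ξ => integral_nonneg fun τ =>
        (h0 (ξ, τ)).trans_eq (by rw [stFourier_eq_fourier]; rfl)
  rw [hX, ofReal_integral_eq_lintegral_ofReal hint (ae_of_all _ h0)]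
  refine lintegral_congr fun z => ?_
  have hj : 0 ≤ jap z.1 := Real.sqrt_nonneg _
  have hm : 0 ≤ modulation z := Real.sqrt_nonneg _
  rw [← ofReal_norm, ← ENNReal.ofReal_mul (by positivity),
    ← ENNReal.ofReal_mul (by positivity), ← ENNReal.ofReal_pow (by positivity), mul_pow, mul_pow,
    ← Real.rpow_mul_natCast hj, ← Real.rpow_mul_natCast hm]
  simp only [Nat.cast_ofNat, mul_comm s, mul_comm b]

theorem XNorm_nonneg {n : ℕ} {E : Type*} [NormedAddCommGroup E] [NormedSpace ℂ E] (s b : ℝ)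
    (ψ : Rn n → ℝ → E) : 0 ≤ XNorm n s b ψ :=
  Real.rpow_nonneg (integral_nonneg fun _ => integral_nonneg fun _ =>
    mul_nonneg (mul_nonneg (Real.rpow_nonneg (Real.sqrt_nonneg _) _)
      (Real.rpow_nonneg (Real.sqrt_nonneg _) _)) (sq_nonneg _)) _

theorem enorm_fourier_cubicSchwartz_prod_le {n : ℕ} (φ : 𝓢(WithLp 2 (Rn n × ℝ), ℂ))
    (z : Rn n × ℝ) :
    ‖𝓕 (cubicSchwartz φ) (WithLp.toLp 2 z)‖ₑ
      ≤ ∫⁻ z₁ : Rn n × ℝ, ∫⁻ z₂ : Rn n × ℝ, ‖𝓕 φ (WithLp.toLp 2 z₁)‖ₑ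
        * ‖𝓕 φ (WithLp.toLp 2 z₂)‖ₑ * ‖𝓕 φ (WithLp.toLp 2 (z + z₂ - z₁))‖ₑ := by
  have hmp := WithLp.volume_preserving_toLp (Rn n) ℝ
  have hemb : MeasurableEmbedding (WithLp.toLp 2 : Rn n × ℝ → WithLp 2 (Rn n × ℝ)) :=
    (MeasurableEquiv.toLp 2 (Rn n × ℝ)).measurableEmbedding
  refine (enorm_fourier_cubicSchwartz_le φ _).trans_eq ?_
  rw [← hmp.lintegral_comp_emb hemb]
  refine lintegral_congr fun z₁ => ?_
  rw [← hmp.lintegral_comp_emb hemb]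
  simp only [WithLp.toLp_add, WithLp.toLp_sub]

theorem XNorm_cubicSchwartz_le {s b b' : ℝ} (hs : 1 < 2 * s) (hs₁ : s ≤ 1) (hb : 1 < 2 * b)
    (hb₁ : b ≤ 1) (hb' : 1 < 4 * b') (hbb' : b' ≤ b) :
    ∃ C > (0 : ℝ), ∀ φ : 𝓢(WithLp 2 (Rn 2 × ℝ), ℂ),
      XNorm 2 s (-b') (fun x t => cubicSchwartz φ (WithLp.toLp 2 (x, t)))
        ≤ C * XNorm 2 s b (fun x t => φ (WithLp.toLp 2 (x, t))) ^ 3 := by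
  obtain ⟨K, hKtop, hK⟩ := kernel_bound hs hb hb'
  refine ⟨3 * K.toReal + 1, by positivity, fun φ => ?_⟩
  set X := XNorm 2 s b (fun x t => φ (WithLp.toLp 2 (x, t))) with hX
  set Y := XNorm 2 s (-b') (fun x t => cubicSchwartz φ (WithLp.toLp 2 (x, t))) with hY
  have hX0 : 0 ≤ X := XNorm_nonneg _ _ _
  have hLX := lintegral_eq_XNorm_sq hs₁ hb₁ φ
  have hLY := lintegral_eq_XNorm_sq hs₁ (by linarith : -b' ≤ 1) (cubicSchwartz φ)
  have hcont (f : 𝓢(WithLp 2 (Rn 2 × ℝ), ℂ)) :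
      Continuous fun z : Rn 2 × ℝ => f (WithLp.toLp 2 z) :=
    f.continuous.comp (WithLp.prod_continuous_toLp 2 _ _)
  have hjm (r : ℝ) : Measurable fun z : Rn 2 × ℝ => jap z.1 ^ r :=
    ((continuous_jap_rpow r).comp continuous_fst).measurable
  have hmm (r : ℝ) : Measurable fun z : Rn 2 × ℝ => modulation z ^ r :=
    (continuous_modulation_rpow r).measurable
  have hj (z : Rn 2 × ℝ) : 0 < jap z.1 := zero_lt_one.trans_le (one_le_jap _)
  have hm (z : Rn 2 × ℝ) : 0 < modulation z := zero_lt_one.trans_le (one_le_modulation _)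
  have hpF (z : Rn 2 × ℝ) (a : ℝ≥0∞) :
      ENNReal.ofReal (jap z.1 ^ (-s) * modulation z ^ (-b))
        * (ENNReal.ofReal (jap z.1 ^ s) * ENNReal.ofReal (modulation z ^ b) * a) = a := by
    rw [← mul_assoc, ← ENNReal.ofReal_mul (Real.rpow_pos_of_pos (hj z) _).le,
      ← ENNReal.ofReal_mul (mul_pos (Real.rpow_pos_of_pos (hj z) _)
        (Real.rpow_pos_of_pos (hm z) _)).le, mul_mul_mul_comm, ← Real.rpow_add (hj z),
      ← Real.rpow_add (hm z)]
    simp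
  have : (volume : Measure (Rn 2 × ℝ)).IsAddHaarMeasure :=
    inferInstanceAs ((volume : Measure (Rn 2)).prod (volume : Measure ℝ)).IsAddHaarMeasure
  have main := lintegral_sq_trilinear_le (μ := (volume : Measure (Rn 2 × ℝ)))
    (J := fun z => ENNReal.ofReal (jap z.1 ^ s))
    (p := fun z => ENNReal.ofReal (jap z.1 ^ (-s) * modulation z ^ (-b)))
    (q := fun z => ENNReal.ofReal (modulation z ^ (-b')))
    (F := fun z => ENNReal.ofReal (jap z.1 ^ s) * ENNReal.ofReal (modulation z ^ b)
        * ‖𝓕 φ (WithLp.toLp 2 z)‖ₑ)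
    (H := fun z => ‖𝓕 (cubicSchwartz φ) (WithLp.toLp 2 z)‖ₑ)
    (hjm s).ennreal_ofReal ((hjm _).mul (hmm _)).ennreal_ofReal (hmm _).ennreal_ofReal
    (((hjm s).ennreal_ofReal.mul (hmm b).ennreal_ofReal).mul (hcont _).measurable.enorm)
    (hcont _).measurable.enorm
    (fun z z₁ z₂ => by
      have h (z : Rn 2 × ℝ) := (Real.rpow_pos_of_pos (hj z) s).le
      rw [← ENNReal.ofReal_add (h _) (h _), ← ENNReal.ofReal_add (add_nonneg (h _) (h _)) (h _)]
      exact ENNReal.ofReal_le_ofReal (jap_rpow_le_add (by linarith) hs₁ _ _ _))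
    (fun z => by
      rw [← ENNReal.ofReal_mul (Real.rpow_pos_of_pos (hj z) _).le, ← mul_assoc,
        ← Real.rpow_add (hj z), add_neg_cancel, Real.rpow_zero, one_mul]
      exact ENNReal.ofReal_le_ofReal
        (Real.rpow_le_rpow_of_exponent_le (one_le_modulation z) (by linarith)))
    (K := K) hK
    (fun z => by
      simp only [hpF]
      exact enorm_fourier_cubicSchwartz_prod_le φ z)
    (hLY ▸ ENNReal.ofReal_ne_top)
  rw [hLX, hLY, ← ENNReal.ofReal_toReal hKtop.ne, ← hX, ← hY, ← ENNReal.ofReal_pow (by positivity),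
    ← ENNReal.ofReal_pow (by positivity), ← ENNReal.ofReal_ofNat 9,
    ← ENNReal.ofReal_mul (by positivity), ← ENNReal.ofReal_mul (by positivity),
    ENNReal.ofReal_le_ofReal_iff (by positivity)] at main
  have hYX : Y ≤ 3 * K.toReal * X ^ 3 :=
    le_of_sq_le_sq (by linarith [main]) (by positivity)
  linarith [pow_nonneg hX0 3]

/-- Trilinear estimate in ℝ^{2+1}. -/
theorem statement_8 :
    ∀ s : ℝ, 4/7 < s → s < 1 →
    ∃ ε₀ > (0:ℝ), ∀ ε : ℝ, 0 < ε → ε < ε₀ →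
    ∃ C > (0:ℝ), ∀ ψ : SchwartzMap (Rn 2 × ℝ) ℂ,
    XNorm 2 s (-(1/2) + 2 * ε)
        (fun x t => ψ (x, t) * (starRingEnd ℂ) (ψ (x, t)) * ψ (x, t))
      ≤ C * XNorm 2 s (1/2 + ε) (fun x t => ψ (x, t)) ^ 3 := by
  intro s hs hs₁
  refine ⟨1 / 16, by norm_num, fun ε hε hε₁ => ?_⟩
  obtain ⟨C, hC, h⟩ := XNorm_cubicSchwartz_le (s := s) (b := 1 / 2 + ε) (b' := 1 / 2 - 2 * ε)
    (by linarith) hs₁.le (by linarith) (by linarith) (by linarith) (by linarith)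
  refine ⟨C, hC, fun ψ => ?_⟩
  convert h (compCLMOfContinuousLinearEquiv ℂ (WithLp.prodContinuousLinearEquiv 2 ℝ (Rn 2) ℝ) ψ)
    using 2
  · ring
  · ext x t
    simp [cubicSchwartz, conjSchwartz, pairing_apply_apply]
    ring
  · rfl

end
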